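/- arXiv:2309.08304 — 3 statements merged into one kernel-verified Lean document; each statement's English description precedes it below -/
import Mathlib

section
/- Let N, q be positive integers and h0, h1 : ℤ/Nℤ → ℤ. Let H0 be the circulant matrix with H0(i,j) = h0(j−i), H1 the reverse circulant matrix with H1(i,j) = h1(i+j), and L_h the ℤ-submodule of (ℤ^N)⁴ spanned by the rows of the 4N×4N block matrix [[I_{2N}, H],[0, q·I_{2N}]] where H = [[H0,H1],[H1,H0]]. If (f0, f1, g0, g1) ∈ L_h, then for every s ∈ ℤ/Nℤ both rotated tuples (f0^(s), f1^(−s), g0^(s), g1^(−s)) and (f1^(s), f0^(−s), g1^(s), g0^(−s)) also lie in L_h. -/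
/-- The circulant matrix of a vector `h0 : ZMod N → ℤ`, with `(i, j)` entry `h0 (j - i)`. -/
def circMat (N : ℕ) (h0 : ZMod N → ℤ) : Matrix (ZMod N) (ZMod N) ℤ :=
  Matrix.of fun i j => h0 (j - i)

/-- The reverse circulant matrix of a vector `h1 : ZMod N → ℤ`, with `(i, j)` entry
`h1 (i + j)`. -/
def revCircMat (N : ℕ) (h1 : ZMod N → ℤ) : Matrix (ZMod N) (ZMod N) ℤ :=
  Matrix.of fun i j => h1 (i + j)

/-- The NTRU lattice of an `ι × ι` integer matrix `M` with modulus `q`: the `ℤ`-submodule of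
`(ι → ℤ) × (ι → ℤ)` spanned by the rows of the block matrix `[[I, M], [0, q•I]]`, each row
being split into its left and right halves. -/
def ntruLattice {ι : Type*} [Fintype ι] [DecidableEq ι] (q : ℕ) (M : Matrix ι ι ℤ) :
    Submodule ℤ ((ι → ℤ) × (ι → ℤ)) :=
  Submodule.span ℤ (Set.range fun i : ι ⊕ ι =>
    ((fun j => (Matrix.fromBlocks 1 M 0 ((q : ℤ) • 1) : Matrix (ι ⊕ ι) (ι ⊕ ι) ℤ) i (Sum.inl j),
      fun j => (Matrix.fromBlocks 1 M 0 ((q : ℤ) • 1) : Matrix (ι ⊕ ι) (ι ⊕ ι) ℤ) i (Sum.inr j)) :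
      (ι → ℤ) × (ι → ℤ)))

/-- An NTRU lattice is stable under every permutation of the coordinates that preserves the
matrix defining it. -/
theorem comp_perm_mem_ntruLattice {ι : Type*} [Fintype ι] [DecidableEq ι] {q : ℕ}
    {M : Matrix ι ι ℤ} (σ : Equiv.Perm ι) (hσ : ∀ i j, M (σ i) (σ j) = M i j)
    {v : (ι → ℤ) × (ι → ℤ)} (hv : v ∈ ntruLattice q M) :
    (v.1 ∘ σ, v.2 ∘ σ) ∈ ntruLattice q M := by
  have hle : ntruLattice q M ≤
      (ntruLattice q M).comap ((LinearMap.funLeft ℤ ℤ σ).prodMap (LinearMap.funLeft ℤ ℤ σ)) := by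
    refine Submodule.span_le.2 ?_
    rintro _ ⟨i, rfl⟩
    refine Submodule.subset_span ⟨i.map σ.symm σ.symm, ?_⟩
    rcases i with i | i <;> obtain ⟨i, rfl⟩ := σ.surjective i <;>
      ext j <;> simp [LinearMap.funLeft_apply, Matrix.one_apply, Matrix.natCast_apply, hσ]
  exact hle hv

/-- If the quadruple `(f0, f1, g0, g1)` lies in the dihedral NTRU lattice `L_h` (with
`H = [[H0, H1], [H1, H0]]`, `H0` circulant with `h0`, `H1` reverse circulant with `h1`),
then so do the rotated quadruples `(f0^(s), f1^(−s), g0^(s), g1^(−s))` and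
`(f1^(s), f0^(−s), g1^(s), g0^(−s))` for every `s`. -/
theorem rotations_mem_dihedral_ntruLattice (N q : ℕ) [NeZero N] (hq : 0 < q)
    (h0 h1 f0 f1 g0 g1 : ZMod N → ℤ)
    (hmem : (Sum.elim f0 f1, Sum.elim g0 g1) ∈
      ntruLattice q (Matrix.fromBlocks (circMat N h0) (revCircMat N h1)
        (revCircMat N h1) (circMat N h0)))
    (s : ZMod N) :
    (Sum.elim (fun i => f0 (i + s)) (fun i => f1 (i - s)),
      Sum.elim (fun i => g0 (i + s)) (fun i => g1 (i - s))) ∈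
        ntruLattice q (Matrix.fromBlocks (circMat N h0) (revCircMat N h1)
          (revCircMat N h1) (circMat N h0)) ∧
    (Sum.elim (fun i => f1 (i + s)) (fun i => f0 (i - s)),
      Sum.elim (fun i => g1 (i + s)) (fun i => g0 (i - s))) ∈
        ntruLattice q (Matrix.fromBlocks (circMat N h0) (revCircMat N h1)
          (revCircMat N h1) (circMat N h0)) := by
  constructor
  · convert comp_perm_mem_ntruLattice
      (Equiv.sumCongr (Equiv.addRight s) (Equiv.subRight s)) ?_ hmem using 2
    · ext (i | i) <;> simp
    · ext (i | i) <;> simp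
    · rintro (i | i) (j | j) <;> simp [circMat, revCircMat]
  · convert comp_perm_mem_ntruLattice
      ((Equiv.sumCongr (Equiv.addRight s) (Equiv.subRight s)).trans (Equiv.sumComm _ _))
      ?_ hmem using 2
    · ext (i | i) <;> simp
    · ext (i | i) <;> simp
    · rintro (i | i) (j | j) <;> simp [circMat, revCircMat]
end

section
/- Let N, q be positive integers and h0, h1, f0, f1, g0, g1, u0, u1 : ℤ/Nℤ → ℤ. Let H0 be the circulant matrix with H0(i,j) = h0(j−i) and H1 the reverse circulant matrix with H1(i,j) = h1(i+j). Suppose f0·H0 + f1·H1 + q·u0 = g0 and f0·H1 + f1·H0 + q·u1 = g1 (row-vector–matrix products). Then (f0+f1)·(H0+H1) + q·(u0+u1) = g0+g1 and (f0−f1)·(H0−H1) + q·(u0−u1) = g0−g1; consequently the pair (f0+f1, g0+g1) lies in the lattice L_{h0+h1} spanned by the rows of [[I_N, H0+H1],[0, q·I_N]], and the pair (f0−f1, g0−g1) lies in the lattice L_{h0−h1} spanned by the rows of [[I_N, H0−H1],[0, q·I_N]]. -/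
/-- The integer combination of the rows of `[[I, M], [0, q•I]]` with coefficients `f` and `u`
lies in the NTRU lattice. -/
theorem mem_ntruLattice_of_vecMul_add_smul_eq {ι : Type*} [Fintype ι] [DecidableEq ι] {q : ℕ}
    {M : Matrix ι ι ℤ} {f g u : ι → ℤ} (h : Matrix.vecMul f M + (q : ℤ) • u = g) :
    (f, g) ∈ ntruLattice q M := by
  subst h
  refine (Submodule.mem_span_range_iff_exists_fun ℤ).2 ⟨Sum.elim f u, ?_⟩
  ext j
  · simp [Prod.fst_sum, Matrix.one_apply]
  · simp [Prod.snd_sum, Matrix.natCast_apply, Matrix.vecMul, dotProduct, mul_comm]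

/-- From `f0·H0 + f1·H1 + q·u0 = g0` and `f0·H1 + f1·H0 + q·u1 = g1` it follows that
`(f0+f1)·(H0+H1) + q·(u0+u1) = g0+g1` and `(f0−f1)·(H0−H1) + q·(u0−u1) = g0−g1`; hence
`(f0+f1, g0+g1) ∈ L_{h0+h1}` and `(f0−f1, g0−g1) ∈ L_{h0−h1}`. -/
theorem reduction_to_half_dimensional_lattices (N q : ℕ) [NeZero N] (hq : 0 < q)
    (h0 h1 f0 f1 g0 g1 u0 u1 : ZMod N → ℤ)
    (heq0 : Matrix.vecMul f0 (circMat N h0) + Matrix.vecMul f1 (revCircMat N h1) +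
      (q : ℤ) • u0 = g0)
    (heq1 : Matrix.vecMul f0 (revCircMat N h1) + Matrix.vecMul f1 (circMat N h0) +
      (q : ℤ) • u1 = g1) :
    (Matrix.vecMul (f0 + f1) (circMat N h0 + revCircMat N h1) + (q : ℤ) • (u0 + u1) =
      g0 + g1) ∧
    (Matrix.vecMul (f0 - f1) (circMat N h0 - revCircMat N h1) + (q : ℤ) • (u0 - u1) =
      g0 - g1) ∧
    (f0 + f1, g0 + g1) ∈ ntruLattice q (circMat N h0 + revCircMat N h1) ∧
    (f0 - f1, g0 - g1) ∈ ntruLattice q (circMat N h0 - revCircMat N h1) := by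
  have hadd : Matrix.vecMul (f0 + f1) (circMat N h0 + revCircMat N h1) + (q : ℤ) • (u0 + u1) =
      g0 + g1 := by
    rw [← heq0, ← heq1, Matrix.add_vecMul, Matrix.vecMul_add, Matrix.vecMul_add, smul_add]
    abel
  have hsub : Matrix.vecMul (f0 - f1) (circMat N h0 - revCircMat N h1) + (q : ℤ) • (u0 - u1) =
      g0 - g1 := by
    rw [← heq0, ← heq1, Matrix.sub_vecMul, Matrix.vecMul_sub, Matrix.vecMul_sub, smul_sub]
    abel
  exact ⟨hadd, hsub, mem_ntruLattice_of_vecMul_add_smul_eq hadd,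
    mem_ntruLattice_of_vecMul_add_smul_eq hsub⟩
end

section
/- Let N, q be positive integers and h0, h1 : ℤ/Nℤ → ℤ, with H0 the circulant matrix of h0 (entries h0(j−i)) and H1 the reverse circulant matrix of h1 (entries h1(i+j)). Suppose the quadruple (f0, f1, g0, g1) lies in the lattice L_h spanned by the rows of [[I_{2N}, H],[0, q·I_{2N}]] with H = [[H0,H1],[H1,H0]]. Then for every s ∈ ℤ/Nℤ, the pair (f0^(s)+f1^(−s), g0^(s)+g1^(−s)) lies in the lattice L_{h0+h1} spanned by the rows of [[I_N, H0+H1],[0, q·I_N]], and both pairs (f0^(s)−f1^(−s), g0^(s)−g1^(−s)) and (f1^(s)−f0^(−s), g1^(s)−g0^(−s)) lie in the lattice L_{h0−h1} spanned by the rows of [[I_N, H0−H1],[0, q·I_N]]. -/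
open Matrix in
/-- A pair `(x, y)` lies in the lattice of `M` exactly when `y ≡ x M` modulo `q`. -/
theorem mem_ntruLattice_iff {ι : Type*} [Fintype ι] [DecidableEq ι] {q : ℕ} {M : Matrix ι ι ℤ}
    {x y : ι → ℤ} :
    (x, y) ∈ ntruLattice q M ↔ ∃ k : ι → ℤ, ∀ j, y j = (x ᵥ* M) j + q * k j := by
  rw [ntruLattice, Submodule.mem_span_range_iff_exists_fun]
  simp only [Fintype.sum_sum_type, Prod.ext_iff, Prod.fst_add, Prod.snd_add, Prod.fst_sum,
    Prod.snd_sum, funext_iff, Pi.add_apply, Finset.sum_apply, Prod.smul_fst, Prod.smul_snd,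
    Pi.smul_apply, fromBlocks_apply₁₁, fromBlocks_apply₁₂, fromBlocks_apply₂₁,
    fromBlocks_apply₂₂, Matrix.smul_apply, Matrix.one_apply, Matrix.zero_apply, smul_eq_mul,
    mul_ite, mul_one, mul_zero, Finset.sum_ite_eq', Finset.mem_univ, if_true,
    Finset.sum_const_zero, add_zero, vecMul, dotProduct]
  constructor
  · rintro ⟨c, hx, hy⟩
    refine ⟨fun i => c (Sum.inr i), fun j => ?_⟩
    simp only [← hx, ← hy, mul_comm (q : ℤ)]
  · rintro ⟨k, hk⟩
    refine ⟨Sum.elim x k, fun j => rfl, fun j => ?_⟩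
    simp only [Sum.elim_inl, Sum.elim_inr, hk, mul_comm (q : ℤ)]

open Matrix in
/-- Rotating a vector rotates its product with a circulant matrix in the same direction. -/
theorem rotate_vecMul_circMat {N : ℕ} [NeZero N] (h f : ZMod N → ℤ) (s j : ZMod N) :
    ((fun i => f (i + s)) ᵥ* circMat N h) j = (f ᵥ* circMat N h) (j + s) := by
  refine Fintype.sum_equiv (Equiv.addRight s) _ _ fun i => ?_
  simp [circMat]

open Matrix in
/-- Rotating a vector rotates its product with a reverse circulant matrix in the opposite
direction. -/
theorem rotate_vecMul_revCircMat {N : ℕ} [NeZero N] (h f : ZMod N → ℤ) (s j : ZMod N) :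
    ((fun i => f (i + s)) ᵥ* revCircMat N h) j = (f ᵥ* revCircMat N h) (j - s) := by
  refine Fintype.sum_equiv (Equiv.addRight s) _ _ fun i => ?_
  simp [revCircMat]

/-- If `(f0, f1, g0, g1)` lies in the dihedral NTRU lattice `L_h`, then for every rotation
amount `s`, `(f0^(s)+f1^(−s), g0^(s)+g1^(−s)) ∈ L_{h0+h1}` and both
`(f0^(s)−f1^(−s), g0^(s)−g1^(−s))` and `(f1^(s)−f0^(−s), g1^(s)−g0^(−s))` lie in
`L_{h0−h1}`. -/
theorem rotations_mem_half_dimensional_lattices (N q : ℕ) [NeZero N] (hq : 0 < q)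
    (h0 h1 f0 f1 g0 g1 : ZMod N → ℤ)
    (hmem : (Sum.elim f0 f1, Sum.elim g0 g1) ∈
      ntruLattice q (Matrix.fromBlocks (circMat N h0) (revCircMat N h1)
        (revCircMat N h1) (circMat N h0)))
    (s : ZMod N) :
    ((fun i => f0 (i + s) + f1 (i - s)), fun i => g0 (i + s) + g1 (i - s)) ∈
      ntruLattice q (circMat N h0 + revCircMat N h1) ∧
    ((fun i => f0 (i + s) - f1 (i - s)), fun i => g0 (i + s) - g1 (i - s)) ∈
      ntruLattice q (circMat N h0 - revCircMat N h1) ∧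
    ((fun i => f1 (i + s) - f0 (i - s)), fun i => g1 (i + s) - g0 (i - s)) ∈
      ntruLattice q (circMat N h0 - revCircMat N h1) := by
  obtain ⟨k, hk⟩ := mem_ntruLattice_iff.1 hmem
  have hg0 (j : ZMod N) := hk (Sum.inl j)
  have hg1 (j : ZMod N) := hk (Sum.inr j)
  simp only [Matrix.vecMul_fromBlocks, Sum.elim_inl, Sum.elim_inr, Sum.elim_comp_inl,
    Sum.elim_comp_inr, Pi.add_apply] at hg0 hg1
  have circ_sub (h f : ZMod N → ℤ) (j : ZMod N) :
      Matrix.vecMul (fun i => f (i - s)) (circMat N h) j =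
        Matrix.vecMul f (circMat N h) (j - s) := by
    simpa only [sub_eq_add_neg] using rotate_vecMul_circMat h f (-s) j
  have revCirc_sub (h f : ZMod N → ℤ) (j : ZMod N) :
      Matrix.vecMul (fun i => f (i - s)) (revCircMat N h) j =
        Matrix.vecMul f (revCircMat N h) (j + s) := by
    simpa only [sub_eq_add_neg, neg_neg] using rotate_vecMul_revCircMat h f (-s) j
  have fun_add (a b : ZMod N → ℤ) : (fun i => a i + b i) = a + b := rfl
  have fun_sub (a b : ZMod N → ℤ) : (fun i => a i - b i) = a - b := rfl
  refine ⟨mem_ntruLattice_iff.2 ⟨fun j => k (Sum.inl (j + s)) + k (Sum.inr (j - s)), fun j => ?_⟩,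
    mem_ntruLattice_iff.2 ⟨fun j => k (Sum.inl (j + s)) - k (Sum.inr (j - s)), fun j => ?_⟩,
    mem_ntruLattice_iff.2 ⟨fun j => k (Sum.inr (j + s)) - k (Sum.inl (j - s)), fun j => ?_⟩⟩
  · rw [fun_add (fun i => f0 (i + s)) fun i => f1 (i - s)]
    simp only [Matrix.add_vecMul, Matrix.vecMul_add, Pi.add_apply, circ_sub, revCirc_sub,
      rotate_vecMul_circMat, rotate_vecMul_revCircMat, hg0, hg1]
    ring
  · rw [fun_sub (fun i => f0 (i + s)) fun i => f1 (i - s)]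
    simp only [Matrix.sub_vecMul, Matrix.vecMul_sub, Pi.sub_apply, circ_sub, revCirc_sub,
      rotate_vecMul_circMat, rotate_vecMul_revCircMat, hg0, hg1]
    ring
  · rw [fun_sub (fun i => f1 (i + s)) fun i => f0 (i - s)]
    simp only [Matrix.sub_vecMul, Matrix.vecMul_sub, Pi.sub_apply, circ_sub, revCirc_sub,
      rotate_vecMul_circMat, rotate_vecMul_revCircMat, hg0, hg1]
    ring
end
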